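/- Let M ≥ 1 be an integer, H a real symmetric positive definite M×M matrix, and m ∈ ℝ^M. Let λ = min_{x ∈ ℝ^M, x ≠ 0} (xᵀH⁻¹x)/|x|² (the smallest eigenvalue of H⁻¹) and μ = max_{1 ≤ k ≤ M} |(H⁻¹m)_k|. Then ∑_{n ∈ ℤ^M} exp(−π²·nᵀH⁻¹n − π·mᵀH⁻¹n) ≤ ( ∑_{n ∈ ℤ} exp(−λ·π²·n² + μ·π·|n|) )^M. (This is the factorized upper bound in the proof of Lemma D.1.) -/

import Mathlib

open Matrix

/-- The quadratic form `v ↦ vᵀ H v` associated with a square matrix `H`. -/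
noncomputable def quadForm {M : ℕ} (H : Matrix (Fin M) (Fin M) ℝ) (v : Fin M → ℝ) : ℝ :=
  v ⬝ᵥ H.mulVec v

/-- The multidimensional sum of a product of nonnegative one-variable terms is the power of the
one-dimensional sum. -/
theorem HasSum.pi_fin_prod_of_nonneg {α : Type*} {f : α → ℝ} {s : ℝ} (hf : HasSum f s)
    (h0 : ∀ a, 0 ≤ f a) (M : ℕ) :
    HasSum (fun n : Fin M → α => ∏ i, f (n i)) (s ^ M) := by
  induction M with
  | zero => simp
  | succ M ih =>
    rw [pow_succ', ← (Fin.consEquiv fun _ : Fin (M + 1) => α).hasSum_iff]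
    have hg : 0 ≤ fun n : Fin M → α => ∏ i, f (n i) :=
      Pi.le_def.2 fun n => Finset.prod_nonneg fun i _ => h0 (n i)
    have hprod := Summable.mul_of_nonneg hf.summable ih.summable (Pi.le_def.2 h0) hg
    have h := hf.mul ih hprod
    simpa only [Function.comp_def, Fin.prod_univ_succ, Fin.consEquiv, Equiv.coe_fn_mk,
      Fin.cons_zero, Fin.cons_succ] using h

theorem summable_exp_neg_sq_add_abs {a : ℝ} (ha : 0 < a) (b : ℝ) :
    Summable fun n : ℤ =>
      Real.exp (-a * Real.pi ^ 2 * (n : ℝ) ^ 2 + b * Real.pi * |(n : ℝ)|) := by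
  refine (summable_pow_mul_jacobiTheta₂_term_bound (b / 2)
    (mul_pos ha Real.pi_pos) 0).congr fun n => ?_
  rw [pow_zero, one_mul]
  push_cast
  congr 1
  ring

theorem neg_dotProduct_mulVec_le_sum {M : ℕ} {A : Matrix (Fin M) (Fin M) ℝ} (hA : A.IsSymm)
    {m : Fin M → ℝ} {b : ℝ} (hb : ∀ k, |A.mulVec m k| ≤ b) (x : Fin M → ℝ) :
    -(m ⬝ᵥ A.mulVec x) ≤ ∑ i, b * |x i| := by
  rw [dotProduct_mulVec, ← mulVec_transpose, hA.eq, dotProduct, ← Finset.sum_neg_distrib]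
  refine Finset.sum_le_sum fun i _ => ?_
  calc -(A.mulVec m i * x i) ≤ |A.mulVec m i * x i| := neg_le_abs _
    _ = |A.mulVec m i| * |x i| := abs_mul _ _
    _ ≤ b * |x i| := mul_le_mul_of_nonneg_right (hb i) (abs_nonneg _)

theorem mul_sum_sq_le_quadForm {M : ℕ} {A : Matrix (Fin M) (Fin M) ℝ} {c : ℝ}
    (hc : c ∈ lowerBounds
      ((fun x : Fin M → ℝ => quadForm A x / (x ⬝ᵥ x)) '' {x | x ≠ 0})) (x : Fin M → ℝ) :
    c * ∑ i, x i ^ 2 ≤ quadForm A x := by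
  by_cases hx : x = 0
  · simp [hx, quadForm]
  · have h := hc ⟨x, hx, rfl⟩
    rw [le_div_iff₀ (by simpa using dotProduct_star_self_pos_iff.2 hx)] at h
    simpa [dotProduct, sq] using h

theorem stmt_10 (M : ℕ) (hM : 1 ≤ M) (H : Matrix (Fin M) (Fin M) ℝ)
    (hsym : H.IsSymm) (hpos : H.PosDef) (m : Fin M → ℝ) (lam mu : ℝ)
    (hlam : IsLeast
      ((fun x : Fin M → ℝ => quadForm H⁻¹ x / (x ⬝ᵥ x)) '' {x | x ≠ 0}) lam)
    (hmu : IsGreatest (Set.range fun k : Fin M => |H⁻¹.mulVec m k|) mu) :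
    (∑' n : Fin M → ℤ,
        Real.exp (-Real.pi ^ 2 * quadForm H⁻¹ (fun i => (n i : ℝ)) -
          Real.pi * (m ⬝ᵥ H⁻¹.mulVec fun i => (n i : ℝ)))) ≤
      (∑' n : ℤ,
        Real.exp (-lam * Real.pi ^ 2 * (n : ℝ) ^ 2 + mu * Real.pi * |(n : ℝ)|)) ^ M := by
  have hlam_pos : 0 < lam := by
    obtain ⟨x, hx, rfl⟩ := hlam.1
    exact div_pos (by simpa [quadForm] using hpos.inv.dotProduct_mulVec_pos hx)
      (by simpa using dotProduct_star_self_pos_iff.2 hx)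
  have hsum := (summable_exp_neg_sq_add_abs hlam_pos mu).hasSum.pi_fin_prod_of_nonneg
    (fun _ => (Real.exp_pos _).le) M
  have hle : ∀ n : Fin M → ℤ,
      Real.exp (-Real.pi ^ 2 * quadForm H⁻¹ (fun i => (n i : ℝ)) -
          Real.pi * (m ⬝ᵥ H⁻¹.mulVec fun i => (n i : ℝ))) ≤
        ∏ i, Real.exp (-lam * Real.pi ^ 2 * (n i : ℝ) ^ 2 + mu * Real.pi * |(n i : ℝ)|) := by
    intro n
    rw [← Real.exp_sum, Real.exp_le_exp]
    have hquad := mul_le_mul_of_nonneg_left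
      (mul_sum_sq_le_quadForm hlam.2 fun i => (n i : ℝ)) (sq_nonneg Real.pi)
    have hlin := mul_le_mul_of_nonneg_left
      (neg_dotProduct_mulVec_le_sum hsym.inv (fun k => hmu.2 ⟨k, rfl⟩) fun i => (n i : ℝ))
      Real.pi_pos.le
    rw [Finset.sum_add_distrib, ← Finset.mul_sum, ← Finset.mul_sum]
    rw [← Finset.mul_sum] at hlin
    linarith
  rw [← hsum.tsum_eq]
  exact (hsum.summable.of_nonneg_of_le (fun _ => (Real.exp_pos _).le) hle).tsum_le_tsum hle
    hsum.summable
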